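/- Let K ∈ ℝ and p_i, p_j ∈ ℝ^n with 1 + K(p_i·p_i) ≠ 0 and 1 + K(p_j·p_j) ≠ 0, and let u_i, u_j ∈ ℝ^n. Define k_{ij} = ((1 + K(p_i·p_j))/(1 + K(p_i·p_i))) p_i - p_j and k_{ji} symmetrically. Then k_{ij}·(T_{p_i} u_i) + k_{ji}·(T_{p_j} u_j) = (p_i - p_j)·(u_i - u_j), where T_p = I + K(p pᵀ). -/

import Mathlib

open scoped BigOperators

noncomputable section

/-- Standard Euclidean dot product on `ℝ^m`. -/
def dot {m : ℕ} (x y : Fin m → ℝ) : ℝ := ∑ i, x i * y i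

/-- The matrix `T_p = I + K (p pᵀ)`. -/
def Tmat {n : ℕ} (K : ℝ) (p : Fin n → ℝ) : Matrix (Fin n) (Fin n) ℝ :=
  1 + K • Matrix.vecMulVec p p

/-- The rigidity-matrix row entry
`k_{ij} = ((1 + K (p_i·p_j))/(1 + K (p_i·p_i))) p_i - p_j`. -/
def kRow {n : ℕ} (K : ℝ) (p_i p_j : Fin n → ℝ) : Fin n → ℝ :=
  ((1 + K * dot p_i p_j) / (1 + K * dot p_i p_i)) • p_i - p_j

theorem dot_kRow_aux {n : ℕ} (K : ℝ) (p q u : Fin n → ℝ) (h : 1 + K * dot p p ≠ 0) :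
    dot (kRow K p q) (Matrix.mulVec (Tmat K p) u) = dot (p - q) u := by
  have hd : ∀ x y : Fin n → ℝ, dot x y = x ⬝ᵥ y := fun _ _ => rfl
  have hT : Matrix.mulVec (Tmat K p) u = u + (K * (p ⬝ᵥ u)) • p := by
    rw [Tmat, Matrix.add_mulVec, Matrix.one_mulVec, Matrix.smul_mulVec,
      Matrix.vecMulVec_mulVec]
    ext i
    simp
    ring
  rw [hT, kRow]
  simp only [hd] at h ⊢
  simp only [sub_dotProduct, dotProduct_add, smul_dotProduct, dotProduct_smul, smul_eq_mul]
  rw [dotProduct_comm q p]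
  field_simp
  ring

theorem edge_constraint_transfer (n : ℕ) (K : ℝ) (p_i p_j u_i u_j : Fin n → ℝ)
    (hi : 1 + K * dot p_i p_i ≠ 0) (hj : 1 + K * dot p_j p_j ≠ 0) :
    dot (kRow K p_i p_j) (Matrix.mulVec (Tmat K p_i) u_i)
        + dot (kRow K p_j p_i) (Matrix.mulVec (Tmat K p_j) u_j)
      = dot (p_i - p_j) (u_i - u_j) := by
  rw [dot_kRow_aux K p_i p_j u_i hi, dot_kRow_aux K p_j p_i u_j hj]
  simp only [dot, ← Finset.sum_add_distrib, Pi.sub_apply]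
  exact Finset.sum_congr rfl fun _ _ => by ring

end
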